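/- arXiv:2207.02596 — 2 statements merged into one kernel-verified Lean document; each statement's English description precedes it below -/
import Mathlib

section
/- In the single-player two-topology reachability MTG A (defined in the context), no strategy is a Greedy NE: for every strategy σ of the player there exists a strategy σ' and a topology t such that the player wins A_t under σ' but loses A_t under σ. -/
/-- A strategy maps nonempty finite histories of states to actions.
(We use all of `List S`; only nonempty histories ever arise in outcomes.) -/
abbrev Strategy (S Act : Type) := List S → Act

/-- Reversed history (most recent state first) of length `i+1` of the play
determined by transition function `δ`, strategy profile `σ` and initial state `s0`. -/
def histR {P S Act : Type} (δ : S → (P → Act) → S) (σ : P → Strategy S Act)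
    (s0 : S) : ℕ → List S
  | 0 => [s0]
  | i + 1 =>
    let h := histR δ σ s0 i
    δ (h.headD s0) (fun p => σ p h.reverse) :: h

/-- The outcome play `s0 s1 s2 ...` with `s_{i+1} = δ (s_i) (λ p, σ p (s0…s_i))`. -/
def outcome {P S Act : Type} (δ : S → (P → Act) → S) (σ : P → Strategy S Act)
    (s0 : S) (i : ℕ) : S :=
  (histR δ σ s0 i).headD s0

/-- The set of states occurring infinitely often in the play `ρ`. -/
def InfOcc {S : Type} (ρ : ℕ → S) : Set S := {s | ∀ N, ∃ i, N ≤ i ∧ ρ i = s}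

/-- The parity condition for priority function `Ω`: the minimum priority among
states occurring infinitely often is even. -/
def ParitySat {S : Type} (Ω : S → ℕ) (ρ : ℕ → S) : Prop :=
  Even (sInf (Ω '' InfOcc ρ))

/-- A multi-topology game over players `P`, states `S`, actions `Act` and
topologies `Top`: an initial state, one transition function per topology, and
one parity priority function per topology and player. -/
structure MTG (P S Act Top : Type) where
  s0 : S
  δ : Top → S → (P → Act) → S
  prio : Top → P → S → ℕ

namespace MTG

variable {P S Act Top : Type}

/-- The outcome play of profile `σ` in the concurrent game `G_t`. -/
def out (G : MTG P S Act Top) (t : Top) (σ : P → Strategy S Act) : ℕ → S :=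
  outcome (G.δ t) σ G.s0

/-- Player `p` wins the profile `σ` in the concurrent game `G_t`. -/
def Wins (G : MTG P S Act Top) (t : Top) (σ : P → Strategy S Act) (p : P) : Prop :=
  ParitySat (G.prio t p) (G.out t σ)

/-- The set of winning topologies of player `p` under profile `σ`. -/
def winTop (G : MTG P S Act Top) (σ : P → Strategy S Act) (p : P) : Set Top :=
  {t | G.Wins t σ p}

/-- Conservative Nash equilibrium. -/
def CNE [DecidableEq P] (G : MTG P S Act Top) (σ : P → Strategy S Act) : Prop :=
  ∀ (p : P) (σ' : Strategy S Act),
    ¬ (G.winTop σ p ⊂ G.winTop (Function.update σ p σ') p)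

/-- Greedy Nash equilibrium. -/
def GNE [DecidableEq P] (G : MTG P S Act Top) (σ : P → Strategy S Act) : Prop :=
  ∀ (p : P) (σ' : Strategy S Act),
    G.winTop (Function.update σ p σ') p ⊆ G.winTop σ p

/-- Nash equilibrium of the concurrent parity game `G_t`. -/
def NEAt [DecidableEq P] (G : MTG P S Act Top) (t : Top) (σ : P → Strategy S Act) : Prop :=
  ∀ (p : P) (σ' : Strategy S Act),
    G.Wins t (Function.update σ p σ') p → G.Wins t σ p

end MTG

/-- The single-player two-topology reachability MTG `A`:
states `Fin 3` (`0 = s0`, `1 = s1`, `2 = s2`), actions `Fin 2` (`0` stands for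
action "1", `1` for action "2"), topologies `Fin 2` (`0 = t1`, `1 = t2`).
In `t1`, action "1" leads from `s0` to `s1` and action "2" to `s2`; in `t2` it is
swapped; `s1` and `s2` are absorbing. The objective is to reach `s1`
(priority `0` on `s1`, priority `1` on `s0` and `s2`). -/
def A : MTG Unit (Fin 3) (Fin 2) (Fin 2) where
  s0 := 0
  δ := fun t s a =>
    if s = 0 then
      (if a () = 0 then (if t = 0 then 1 else 2) else (if t = 0 then 2 else 1))
    else s
  prio := fun _ _ s => if s = 1 then 0 else 1

theorem infOcc_eq_singleton {S : Type} {ρ : ℕ → S} {c : S} {n : ℕ}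
    (h : ∀ i, n ≤ i → ρ i = c) : InfOcc ρ = {c} := by
  ext s
  constructor
  · intro hs
    obtain ⟨i, hi, rfl⟩ := hs n
    exact h i hi
  · rintro rfl N
    exact ⟨max N n, le_max_left _ _, h _ (le_max_right _ _)⟩

theorem paritySat_iff_of_eventually_const {S : Type} (Ω : S → ℕ) {ρ : ℕ → S} {c : S} {n : ℕ}
    (h : ∀ i, n ≤ i → ρ i = c) : ParitySat Ω ρ ↔ Even (Ω c) := by
  simp [ParitySat, infOcc_eq_singleton h]

theorem outcome_succ {P S Act : Type} (δ : S → (P → Act) → S) (σ : P → Strategy S Act)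
    (s0 : S) (i : ℕ) :
    outcome δ σ s0 (i + 1) = δ (outcome δ σ s0 i) (fun p => σ p (histR δ σ s0 i).reverse) :=
  rfl

/-- In `A`, from the first step on the play stays in the state selected by the first action. -/
theorem A_out_eq (t : Fin 2) (σ : Unit → Strategy (Fin 3) (Fin 2)) (i : ℕ) (hi : 1 ≤ i) :
    A.out t σ i = if σ () [0] = t then 1 else 2 := by
  induction i, hi using Nat.le_induction with
  | base =>
    change (if σ () [0] = 0 then (if t = 0 then (1 : Fin 3) else 2)
      else (if t = 0 then 2 else 1)) = _
    generalize σ () [0] = a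
    revert a t
    decide
  | succ i _ ih =>
    have hne : A.out t σ i ≠ 0 := by
      rw [ih]
      split_ifs <;> decide
    rw [← ih]
    exact (outcome_succ (A.δ t) σ A.s0 i).trans (if_neg hne)

theorem A_wins_iff (t : Fin 2) (σ : Unit → Strategy (Fin 3) (Fin 2)) :
    A.Wins t σ () ↔ σ () [0] = t := by
  rw [MTG.Wins, paritySat_iff_of_eventually_const _ (A_out_eq t σ)]
  by_cases h : σ () [0] = t <;> simp [A, h]

/-- in the MTG `A`, no strategy is a Greedy NE: for every strategy `σ`
of the (single) player there is a strategy `σ'` and a topology `t` such that the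
player wins `A_t` under the deviation `σ'` but loses `A_t` under `σ`. -/
theorem A_has_no_gne :
    ∀ σ : Unit → Strategy (Fin 3) (Fin 2),
      ¬ A.GNE σ ∧
      ∃ (σ' : Strategy (Fin 3) (Fin 2)) (t : Fin 2),
        A.Wins t (Function.update σ () σ') () ∧ ¬ A.Wins t σ () := by
  intro σ
  obtain ⟨t, ht⟩ := exists_ne (σ () [0])
  have hwin : A.Wins t (Function.update σ () fun _ => t) () := by
    simp [A_wins_iff]
  have hlose : ¬ A.Wins t σ () := fun h => ht ((A_wins_iff t σ).1 h).symm
  exact ⟨fun hG => hlose (hG () (fun _ => t) hwin), fun _ => t, t, hwin, hlose⟩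
end

section
/- In the router MTG R (defined in the context), the strategy profile in which blue's action on a history of length n is 1 if n mod 4 ∈ {2, 3} and 0 otherwise, and red's action on a history of length n is 1 if n mod 4 ∈ {0, 1} and 0 otherwise, satisfies WinTop_blue = WinTop_red = {t1, t2}; consequently this profile is a Greedy NE (and hence a Conservative NE) of R. -/
/-- Priority function of the Büchi objective "visit `x` infinitely often". -/
def reach (x : Fin 3) : Fin 3 → ℕ := fun s => if s = x then 0 else 1

/-- The router MTG `R`: players `Bool` (`true = blue`, `false = red`), states
`Fin 3` (`0 = ready`, `1 = send1`, `2 = send2`), actions `Fin 2`, topologies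
`Fin 2` (`0 = t1`, `1 = t2`). In `t1`, from `ready`, blue playing `1` leads to
`send1`, otherwise red playing `1` leads to `send2`, otherwise stay in `ready`;
in `t2` the roles are swapped; from `send1` and `send2` every action profile leads
back to `ready`. In `t1`, blue's objective is to visit `send1` infinitely often and
red's to visit `send2` infinitely often; in `t2` the objectives are swapped. -/
def R : MTG Bool (Fin 3) (Fin 2) (Fin 2) where
  s0 := 0
  δ := fun t s a =>
    if s = 0 then
      (if t = 0 then
        (if a true = 1 then 1 else if a false = 1 then 2 else 0)
      else
        (if a false = 1 then 1 else if a true = 1 then 2 else 0))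
    else 0
  prio := fun t p =>
    if (t = 0 ∧ p = true) ∨ (t = 1 ∧ p = false) then reach 1 else reach 2

/-- The strategy profile: blue plays `1` on histories of length `n` with
`n % 4 ∈ {2, 3}` and `0` otherwise; red plays `1` on histories of length `n` with
`n % 4 ∈ {0, 1}` and `0` otherwise. -/
def sigmaR : Bool → Strategy (Fin 3) (Fin 2) := fun p h =>
  if p then
    (if h.length % 4 = 2 ∨ h.length % 4 = 3 then 1 else 0)
  else
    (if h.length % 4 = 0 ∨ h.length % 4 = 1 then 1 else 0)

theorem length_histR {P S Act : Type} (δ : S → (P → Act) → S) (σ : P → Strategy S Act)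
    (s0 : S) (i : ℕ) : (histR δ σ s0 i).length = i + 1 := by
  induction i with
  | zero => rfl
  | succ i ih => simp [histR, ih]

/-- A play satisfies the Büchi objective of a state it visits infinitely often. -/
theorem paritySat_reach {x : Fin 3} {ρ : ℕ → Fin 3} (h : x ∈ InfOcc ρ) :
    ParitySat (reach x) ρ := by
  have h0 : 0 ∈ reach x '' InfOcc ρ := ⟨x, h, by simp [reach]⟩
  simp [ParitySat, Nat.sInf_eq_zero.2 (Or.inl h0)]

theorem MTG.GNE.cne {P S Act Top : Type} [DecidableEq P] {G : MTG P S Act Top}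
    {σ : P → Strategy S Act} (h : G.GNE σ) : G.CNE σ :=
  fun p σ' hlt => hlt.2 (h p σ')

theorem MTG.gne_of_winTop_eq_univ {P S Act Top : Type} [DecidableEq P] {G : MTG P S Act Top}
    {σ : P → Strategy S Act} (h : ∀ p, G.winTop σ p = Set.univ) : G.GNE σ :=
  fun p σ' => by rw [h p]; exact Set.subset_univ _

theorem R_out_succ (t : Fin 2) (i : ℕ) :
    R.out t sigmaR (i + 1) =
      if R.out t sigmaR i = 0 then
        (if t = 0 then
          (if i % 4 = 1 ∨ i % 4 = 2 then 1 else 2)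
        else
          (if i % 4 = 1 ∨ i % 4 = 2 then 2 else 1))
      else 0 := by
  have hstep := outcome_succ (R.δ t) sigmaR R.s0 i
  change R.out t sigmaR (i + 1) = R.δ t (R.out t sigmaR i) _ at hstep
  rw [hstep]
  have hlt : i % 4 < 4 := Nat.mod_lt _ (by norm_num)
  simp only [R, sigmaR, List.length_reverse, length_histR, Nat.add_mod i 1 4]
  interval_cases i % 4 <;> simp

/-- The router is in state `ready` at all even times. -/
theorem R_out_even (t : Fin 2) (k : ℕ) : R.out t sigmaR (2 * k) = 0 := by
  induction k with
  | zero => rfl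
  | succ k ih =>
    rw [Nat.mul_succ, R_out_succ, R_out_succ, ih]
    split_ifs <;> simp_all

theorem mem_infOcc_R_out (t : Fin 2) {x : Fin 3} (hx : x ≠ 0) :
    x ∈ InfOcc (R.out t sigmaR) := by
  intro N
  have h0 : R.out t sigmaR (4 * N + 1) = if t = 0 then 2 else 1 := by
    rw [R_out_succ, show 4 * N = 2 * (2 * N) by ring, R_out_even]
    simp [show 2 * (2 * N) % 4 = 0 by omega]
  have h2 : R.out t sigmaR (4 * N + 2 + 1) = if t = 0 then 1 else 2 := by
    rw [R_out_succ, show 4 * N + 2 = 2 * (2 * N + 1) by ring, R_out_even]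
    simp [show 2 * (2 * N + 1) % 4 = 2 by omega]
  have hcases : x = R.out t sigmaR (4 * N + 1) ∨ x = R.out t sigmaR (4 * N + 2 + 1) := by
    rw [h0, h2]
    clear h0 h2
    revert x t
    decide
  rcases hcases with h | h
  · exact ⟨_, by omega, h.symm⟩
  · exact ⟨_, by omega, h.symm⟩

theorem R_winTop_sigmaR (p : Bool) : R.winTop sigmaR p = Set.univ := by
  refine Set.eq_univ_of_forall fun t => ?_
  have hprio : R.prio t p = reach 1 ∨ R.prio t p = reach 2 := by
    simp only [R]
    split_ifs <;> simp
  change ParitySat (R.prio t p) (R.out t sigmaR)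
  rcases hprio with h | h <;> rw [h]
  · exact paritySat_reach (mem_infOcc_R_out t (by decide))
  · exact paritySat_reach (mem_infOcc_R_out t (by decide))

/-- in the router MTG `R`, the profile `sigmaR` wins both topologies
for both players; consequently it is a Greedy NE and hence a Conservative NE. -/
theorem router_profile_wins_everywhere_and_is_gne :
    R.winTop sigmaR true = ({0, 1} : Set (Fin 2)) ∧
    R.winTop sigmaR false = ({0, 1} : Set (Fin 2)) ∧
    R.GNE sigmaR ∧ R.CNE sigmaR := by
  have huniv : (Set.univ : Set (Fin 2)) = {0, 1} := by
    ext t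
    fin_cases t <;> simp
  have hgne : R.GNE sigmaR := MTG.gne_of_winTop_eq_univ R_winTop_sigmaR
  exact ⟨(R_winTop_sigmaR true).trans huniv, (R_winTop_sigmaR false).trans huniv, hgne, hgne.cne⟩
end
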